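/- Define the code weight of a strong Bruhat cover v ⋖ v·t_{ij} (i<j) in S_n as 1 + 2b, where b = #{k : i<k<j, v(k) > v(j)}. Then the sum over all saturated chains from the identity e to the longest element w₀ of the product of the code weights along the chain equals C(n,2)!. -/

import Mathlib

open Equiv Finset
open scoped Classical

/-- Number of inversions (Coxeter length) of a permutation of `Fin n`. -/
def invCount {n : ℕ} (v : Equiv.Perm (Fin n)) : ℕ :=
  (Finset.univ.filter (fun p : Fin n × Fin n => p.1 < p.2 ∧ v p.2 < v p.1)).card

/-- `a` statistic of a (candidate) cover `v ⋖ v·t_{ij}`. -/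
def aQ {n : ℕ} (v : Equiv.Perm (Fin n)) (i j : Fin n) : ℕ :=
  (Finset.univ.filter (fun k : Fin n => k < i ∧ v i < v k ∧ v k < v j)).card

/-- `b` statistic. -/
def bQ {n : ℕ} (v : Equiv.Perm (Fin n)) (i j : Fin n) : ℕ :=
  (Finset.univ.filter (fun k : Fin n => i < k ∧ k < j ∧ v j < v k)).card

/-- `c` statistic. -/
def cQ {n : ℕ} (v : Equiv.Perm (Fin n)) (i j : Fin n) : ℕ :=
  (Finset.univ.filter (fun k : Fin n => j < k ∧ v i < v k ∧ v k < v j)).card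

/-- `d` statistic. -/
def dQ {n : ℕ} (v : Equiv.Perm (Fin n)) (i j : Fin n) : ℕ :=
  (Finset.univ.filter (fun k : Fin n => i < k ∧ k < j ∧ v k < v i)).card

/-- Covering relation in strong Bruhat order. -/
def BruhatCov {n : ℕ} (v w : Equiv.Perm (Fin n)) : Prop :=
  ∃ i j : Fin n, i < j ∧ w = v * Equiv.swap i j ∧ invCount w = invCount v + 1

/-- Weighted count of saturated chains from `v` to `w` in strong Bruhat order:
a saturated chain is a sequence `v = c 0 ⋖ c 1 ⋖ ⋯ ⋖ c m = w` of covers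
(its length is necessarily `m = ℓ(w) - ℓ(v)`), and the weight of a chain is the
product of the weights of its covering steps. -/
noncomputable def chainSum {n : ℕ} {R : Type*} [CommSemiring R]
    (wt : Equiv.Perm (Fin n) → Equiv.Perm (Fin n) → R)
    (v w : Equiv.Perm (Fin n)) : R :=
  ∑ c ∈ Finset.univ.filter
      (fun c : Fin (invCount w - invCount v + 1) → Equiv.Perm (Fin n) =>
        c 0 = v ∧ c (Fin.last _) = w ∧
          ∀ i : Fin (invCount w - invCount v), BruhatCov (c i.castSucc) (c i.succ)),
    ∏ i : Fin (invCount w - invCount v), wt (c i.castSucc) (c i.succ)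

/-- The code weight `1 + 2b` of a cover `v ⋖ u = v·t_{ij}` (as a sum over the unique
transposition realizing the cover). -/
def codeWt {n : ℕ} (v u : Equiv.Perm (Fin n)) : ℕ :=
  ∑ p ∈ Finset.univ.filter
      (fun p : Fin n × Fin n => p.1 < p.2 ∧ u = v * Equiv.swap p.1 p.2),
    (1 + 2 * bQ v p.1 p.2)

section NilCoxeter

variable {E : Type*} [Ring E]

/-- The product `(1 + u (m-1)) ⋯ (1 + u 0)`. -/
def descProd (u : ℕ → E) : ℕ → E
  | 0 => 1
  | m + 1 => (1 + u m) * descProd u m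

/-- The Fomin–Stanley product, with all variables specialised to `1`. -/
def schubProd : (ℕ → E) → ℕ → E
  | _, 0 => 1
  | u, m + 1 => descProd u (m + 1) * schubProd (fun k => u (k + 1)) m

theorem commute_descProd {u : ℕ → E} {x : E} {m : ℕ} (h : ∀ k < m, Commute x (u k)) :
    Commute x (descProd u m) := by
  induction m with
  | zero => exact Commute.one_right x
  | succ m ih =>
    exact ((Commute.one_right x).add_right (h m m.lt_succ_self)).mul_right
      (ih fun k hk => h k (hk.trans m.lt_succ_self))

/-- A family of elements satisfying the nilCoxeter relations of type `A`. -/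
structure IsNilCoxeter (u : ℕ → E) : Prop where
  sq : ∀ k, u k * u k = 0
  comm : ∀ k l, k + 2 ≤ l → Commute (u k) (u l)
  braid : ∀ k, u k * u (k + 1) * u k = u (k + 1) * u k * u (k + 1)

theorem IsNilCoxeter.shift {u : ℕ → E} (hu : IsNilCoxeter u) :
    IsNilCoxeter fun k => u (k + 1) where
  sq k := hu.sq _
  comm k l h := hu.comm _ _ (by lia)
  braid k := hu.braid _

theorem IsNilCoxeter.bracket_descProd {u : ℕ → E} (hu : IsNilCoxeter u) {L : E}
    (hL : ∀ k, L * u k = u k * L + u k) (m : ℕ) :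
    L * descProd u m = descProd u m * L
      + (∑ k ∈ range m, ((k : E) + 1) * u k) * descProd u m
      - descProd u m * ∑ k ∈ range m, (k : E) * u k := by
  induction m with
  | zero => simp [descProd]
  | succ m ih =>
    have key : (m : E) * (u m * descProd u m) + (∑ k ∈ range m, ((k : E) + 1) * u k) * u m
          * descProd u m - u m * (∑ k ∈ range m, ((k : E) + 1) * u k) * descProd u m
        = (m : E) * ((1 + u m) * descProd u m * u m) := by
      cases m with
      | zero => simp [descProd]
      | succ m =>
        have h1 : (∑ k ∈ range m, ((k : E) + 1) * u k) * u (m + 1)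
            = u (m + 1) * ∑ k ∈ range m, ((k : E) + 1) * u k := by
          refine Commute.sum_left _ _ _ fun k hk => ?_
          have h2 := hu.comm k (m + 1) (by have := mem_range.1 hk; lia)
          exact ((Nat.cast_commute k _).add_left (Commute.one_left _)).mul_left h2
        have h3 : descProd u m * u (m + 1) = u (m + 1) * descProd u m :=
          ((commute_descProd fun k hk => (hu.comm k (m + 1) (by lia)).symm).eq).symm
        have h4 : ((m : E) + 1) * u (m + 1) = u (m + 1) * ((m : E) + 1) :=
          ((Nat.cast_commute m _).add_left (Commute.one_left _)).eq
        have h5 : u (m + 1) + u m * u (m + 1) - u (m + 1) * u m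
            + (u (m + 1) + u m * u (m + 1) - u (m + 1) * u m) * u m
            = (1 + u (m + 1)) * (1 + u m) * u (m + 1) := by
          have e1 := hu.sq m
          have e2 := hu.sq (m + 1)
          have e3 := hu.braid m
          simp only [mul_add, add_mul, sub_mul, one_mul, mul_one, e2, e3]
          rw [mul_assoc (u (m + 1)) (u m) (u m), e1]
          noncomm_ring
        rw [sum_range_succ, add_mul, mul_add, h1]
        have h6 : descProd u (m + 1) = (1 + u m) * descProd u m := rfl
        rw [h6]
        have h7 : (1 + u (m + 1)) * ((1 + u m) * descProd u m) * u (m + 1)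
            = (1 + u (m + 1)) * (1 + u m) * u (m + 1) * descProd u m := by
          simp only [mul_assoc, h3]
        rw [h7, ← h5, ← mul_assoc (u (m + 1)) ((m : E) + 1), ← h4]
        push_cast
        noncomm_ring
    have h6 : descProd u (m + 1) = (1 + u m) * descProd u m := rfl
    have h8 : (m : E) * u m = u m * m := (Nat.cast_commute m _).eq
    have h9 : L * ((1 + u m) * descProd u m) = (1 + u m) * (L * descProd u m)
        + u m * descProd u m := by
      rw [← mul_assoc, mul_add, hL]; noncomm_ring
    have h10 : (m : E) * ((1 + u m) * descProd u m * u m)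
        = (1 + u m) * descProd u m * ((m : E) * u m) := by
      rw [← mul_assoc, (Nat.cast_commute m _).eq, mul_assoc]
    rw [h10] at key
    rw [h6, h9, ih, sum_range_succ, sum_range_succ, mul_add _ _ ((m : E) * u m), ← key]
    have h11 : ((m : E) + 1) * u m * ((1 + u m) * descProd u m)
        = ((m : E) + 1) * (u m * descProd u m) := by
      rw [mul_assoc, ← mul_assoc (u m), mul_add, hu.sq, mul_one, add_zero]
    rw [add_mul _ (((m : E) + 1) * u m), h11]
    noncomm_ring

theorem IsNilCoxeter.bracket_schubProd {u : ℕ → E} (hu : IsNilCoxeter u) {L : E}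
    (hL : ∀ k, L * u k = u k * L + u k) (m : ℕ) :
    L * schubProd u m = schubProd u m * L
      + (∑ k ∈ range m, ((k : E) + 1) * u k) * schubProd u m := by
  induction m generalizing u with
  | zero => simp [schubProd]
  | succ m ih =>
    have h := ih hu.shift (fun k => hL _)
    have hd := hu.bracket_descProd hL (m + 1)
    rw [sum_range_succ' (fun k => (k : E) * u k)] at hd
    simp only [Nat.cast_zero, zero_mul, add_zero, Nat.cast_add, Nat.cast_one] at hd
    rw [schubProd, ← mul_assoc, hd, sub_mul, add_mul, mul_assoc _ L, h]
    noncomm_ring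

end NilCoxeter

section Length

variable {n : ℕ}

theorem invCount_lt_mul_swap {v : Perm (Fin n)} {i j : Fin n} (hij : i < j) (hv : v i < v j) :
    invCount v < invCount (v * swap i j) := by
  have hmaps : ∀ p ∈ univ.filter (fun p : Fin n × Fin n => p.1 < p.2 ∧ v p.2 < v p.1),
      (if swap i j p.1 < swap i j p.2 then (swap i j p.1, swap i j p.2) else p) ∈
        (univ.filter (fun p : Fin n × Fin n => p.1 < p.2 ∧
          (v * swap i j) p.2 < (v * swap i j) p.1)).erase (i, j) := by
    rintro ⟨a, b⟩ hp
    simp only [mem_filter, mem_univ, true_and] at hp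
    simp only [mem_erase, mem_filter, mem_univ, true_and]
    simp only [Perm.mul_apply]
    split_ifs with h
    · simp only [swap_apply_self, ne_eq, Prod.mk.injEq]
      refine ⟨?_, h, hp.2⟩
      rintro ⟨h1, h2⟩
      rw [swap_apply_eq_iff, swap_apply_left] at h1
      rw [swap_apply_eq_iff, swap_apply_right] at h2
      subst h1 h2
      exact absurd hp.1 (by lia)
    · have := hp.1
      have := hp.2
      simp only [swap_apply_def] at h ⊢
      refine ⟨?_, ?_, ?_⟩ <;> grind
  have hinj : Set.InjOn (fun p : Fin n × Fin n =>
      if swap i j p.1 < swap i j p.2 then (swap i j p.1, swap i j p.2) else p)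
      (univ.filter (fun p : Fin n × Fin n => p.1 < p.2 ∧ v p.2 < v p.1)) := by
    rintro ⟨a, b⟩ hp ⟨c, d⟩ hq h
    simp only [coe_filter, mem_univ, true_and, Set.mem_ofPred_eq] at hp hq
    dsimp only at h
    have h1 := hp.1
    have h2 := hq.1
    split_ifs at h with h3 h4 h4
    · simpa using h
    · simp only [Prod.mk.injEq] at h
      rw [← h.1, ← h.2] at h4
      simp only [swap_apply_self] at h4
      exact absurd h1 h4
    · simp only [Prod.mk.injEq] at h
      rw [h.1, h.2] at h3
      simp only [swap_apply_self] at h3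
      exact absurd h2 h3
    · exact h
  refine (card_le_card_of_injOn _ hmaps hinj).trans_lt (card_erase_lt_of_mem ?_)
  simp only [mem_filter, mem_univ, true_and, hij]
  simpa using hv

/-- A transposition that raises the length by one has no intermediate value between its ends. -/
theorem cover_cond {v : Perm (Fin n)} {i j : Fin n} (hij : i < j)
    (h : invCount (v * swap i j) = invCount v + 1) :
    v i < v j ∧ ∀ m, i < m → m < j → v i < v m → ¬ v m < v j := by
  have hv : v i < v j := by
    by_contra hn
    have h1 : v j < v i := lt_of_le_of_ne (not_lt.1 hn) (fun e => hij.ne' (v.injective e))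
    have h2 := invCount_lt_mul_swap (v := v * swap i j) hij (by simpa using h1)
    rw [mul_assoc, swap_mul_self, mul_one] at h2
    lia
  refine ⟨hv, fun m him hmj h1 h2 => ?_⟩
  have a1 := invCount_lt_mul_swap him h1
  have a2 := invCount_lt_mul_swap (v := v * swap i m) hmj
    (by simp [swap_apply_of_ne_of_ne hij.ne' hmj.ne', hv])
  have a3 := invCount_lt_mul_swap (v := v * swap i m * swap m j) him
    (by simp [swap_apply_of_ne_of_ne him.ne hij.ne, swap_apply_of_ne_of_ne hij.ne' hmj.ne', h2])
  have e : v * swap i m * swap m j * swap i m = v * swap i j := by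
    rw [mul_assoc, mul_assoc, ← mul_assoc (swap i m), swap_comm i m, swap_comm m j,
      swap_mul_swap_mul_swap hmj.ne' hij.ne', swap_comm]
  rw [e] at a3
  lia

theorem invCount_swap_mul {w : Perm (Fin n)} {a b : Fin n} (hab : b.val = a.val + 1)
    (h : w.symm a < w.symm b) : invCount (swap a b * w) = invCount w + 1 := by
  have e : univ.filter (fun p : Fin n × Fin n => p.1 < p.2 ∧
      (swap a b * w) p.2 < (swap a b * w) p.1)
      = insert (w.symm a, w.symm b)
        (univ.filter (fun p : Fin n × Fin n => p.1 < p.2 ∧ w p.2 < w p.1)) := by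
    ext ⟨x, y⟩
    obtain ⟨x, rfl⟩ := w.symm.surjective x
    obtain ⟨y, rfl⟩ := w.symm.surjective y
    simp only [mem_filter, mem_univ, true_and, mem_insert, Prod.mk.injEq]
    simp only [Perm.mul_apply, apply_symm_apply, EmbeddingLike.apply_eq_iff_eq, swap_apply_def]
    grind
  rw [invCount, invCount, e, card_insert_of_notMem]
  simp only [mem_filter, mem_univ, true_and, apply_symm_apply, not_and]
  lia

theorem invCount_one : invCount (1 : Perm (Fin n)) = 0 := by
  simp only [invCount, card_eq_zero, filter_eq_empty_iff]
  exact fun p _ h => lt_asymm h.1 h.2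

theorem card_lt_pairs : (univ.filter (fun p : Fin n × Fin n => p.1 < p.2)).card = n.choose 2 := by
  have h := card_filter (fun p : Fin n × Fin n => p.1 < p.2) univ
  rw [h, Fintype.sum_prod_type_right]
  simp only [← card_filter]
  have : ∀ j : Fin n, (univ.filter (fun i : Fin n => i < j)).card = j := fun j => by
    have e : univ.filter (fun i : Fin n => i < j) = Finset.Iio j := by ext; simp
    rw [e, Fin.card_Iio]
  simp only [this]
  rw [Fin.sum_univ_eq_sum_range (fun i => i), sum_range_id, Nat.choose_two_right]

theorem invCount_revPerm : invCount (Fin.revPerm : Perm (Fin n)) = n.choose 2 := by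
  rw [← card_lt_pairs, invCount]
  congr 1
  ext p
  simp

theorem eq_revPerm_of_invCount {w : Perm (Fin n)} (h : invCount w = n.choose 2) :
    w = Fin.revPerm := by
  have h1 : univ.filter (fun p : Fin n × Fin n => p.1 < p.2 ∧ w p.2 < w p.1)
      = univ.filter (fun p : Fin n × Fin n => p.1 < p.2) :=
    eq_of_subset_of_card_le (fun p => by simp +contextual) (by rw [card_lt_pairs, ← h]; rfl)
  have h2 : StrictMono ⇑(w * Fin.revPerm : Perm (Fin n)) := fun i j hij => by
    have := (Finset.ext_iff.1 h1 (Fin.rev j, Fin.rev i)).2 (by simpa using hij)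
    simp only [mem_filter, mem_univ, true_and] at this
    rw [Perm.mul_apply, Perm.mul_apply, Fin.revPerm_apply, Fin.revPerm_apply]
    exact this.2
  have h3 : ⇑(w * Fin.revPerm : Perm (Fin n)) = id :=
    (StrictMono.range_inj h2 strictMono_id).1 (by rw [Equiv.range_eq_univ, Set.range_id])
  have h4 : (Fin.revPerm : Perm (Fin n)) * Fin.revPerm = 1 := by ext; simp
  calc w = w * Fin.revPerm * Fin.revPerm := by rw [mul_assoc, h4, mul_one]
    _ = Fin.revPerm := by rw [DFunLike.coe_injective (h3.trans Perm.coe_one.symm), one_mul]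

end Length

section Operators

variable {n : ℕ}

theorem symm_swap_mul_apply (w : Perm (Fin n)) (a b c : Fin n) :
    (swap a b * w).symm c = w.symm (swap a b c) := by
  rw [Perm.mul_def, symm_trans_apply, symm_swap]

/-- Left multiplication by the simple transposition of the values `a`, `b`, restricted to the
permutations of which it is a left descent, acting on functions. -/
def lowerOp (a b : Fin n) : Module.End ℤ (Perm (Fin n) → ℤ) where
  toFun F w := if w.symm b < w.symm a then F (swap a b * w) else 0
  map_add' F G := by ext w; simp only [Pi.add_apply]; split_ifs <;> simp
  map_smul' r F := by ext w; simp

theorem lowerOp_apply (a b : Fin n) (F : Perm (Fin n) → ℤ) (w : Perm (Fin n)) :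
    lowerOp a b F w = if w.symm b < w.symm a then F (swap a b * w) else 0 := rfl

theorem invCount_of_descent {a b : Fin n} (hab : b.val = a.val + 1) {w : Perm (Fin n)}
    (h : w.symm b < w.symm a) : invCount w = invCount (swap a b * w) + 1 := by
  have := invCount_swap_mul (w := swap a b * w) hab (by simpa [symm_swap_mul_apply] using h)
  rwa [swap_mul_self_mul] at this

/-- `lowerOp` for the values `k`, `k + 1`, and zero when these are out of range. -/
def simpleOp (n k : ℕ) : Module.End ℤ (Perm (Fin n) → ℤ) :=
  if h : k + 1 < n then lowerOp ⟨k, by lia⟩ ⟨k + 1, h⟩ else 0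

/-- Multiplication of functions on permutations by the length. -/
def lengthOp (n : ℕ) : Module.End ℤ (Perm (Fin n) → ℤ) where
  toFun F w := invCount w * F w
  map_add' F G := by ext w; simp [mul_add]
  map_smul' r F := by ext w; simp [mul_left_comm]

/-- The code-weighted sum over the upper covers, acting on functions. -/
def codeOp (n : ℕ) : Module.End ℤ (Perm (Fin n) → ℤ) where
  toFun F w := ∑ p : Fin n × Fin n,
    if p.1 < p.2 ∧ invCount (w * swap p.1 p.2) = invCount w + 1 then
      (1 + 2 * (bQ w p.1 p.2 : ℤ)) * F (w * swap p.1 p.2) else 0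
  map_add' F G := by
    ext w
    simp only [Pi.add_apply, ← sum_add_distrib]
    refine sum_congr rfl fun p _ => ?_
    split_ifs <;> ring
  map_smul' r F := by
    ext w
    simp only [Pi.smul_apply, smul_eq_mul, mul_sum, RingHom.id_apply]
    refine sum_congr rfl fun p _ => ?_
    split_ifs <;> ring

theorem lengthOp_apply (F : Perm (Fin n) → ℤ) (w : Perm (Fin n)) :
    lengthOp n F w = invCount w * F w := rfl

theorem codeOp_apply (F : Perm (Fin n) → ℤ) (w : Perm (Fin n)) :
    codeOp n F w = ∑ p : Fin n × Fin n,
      if p.1 < p.2 ∧ invCount (w * swap p.1 p.2) = invCount w + 1 then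
        (1 + 2 * (bQ w p.1 p.2 : ℤ)) * F (w * swap p.1 p.2) else 0 := rfl

theorem isNilCoxeter_simpleOp : IsNilCoxeter (simpleOp n) where
  sq k := by
    unfold simpleOp
    split_ifs with h
    · refine LinearMap.ext fun F => funext fun w => ?_
      simp only [Module.End.mul_apply, lowerOp_apply, symm_swap_mul_apply, swap_apply_left,
        swap_apply_right]
      split_ifs with h1 h2
      · exact absurd h1 (lt_asymm h2)
      all_goals rfl
    · simp
  comm k l hkl := by
    unfold simpleOp
    split_ifs with h h' h'
    · refine LinearMap.ext fun F => funext fun w => ?_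
      simp only [Module.End.mul_apply, lowerOp_apply, symm_swap_mul_apply]
      have e : ∀ {x y z : ℕ} {hx : x < n} {hy : y < n} {hz : z < n}, z ≠ x → z ≠ y →
          swap (⟨x, hx⟩ : Fin n) ⟨y, hy⟩ ⟨z, hz⟩ = ⟨z, hz⟩ := fun h1 h2 =>
        swap_apply_of_ne_of_ne (by simpa using h1) (by simpa using h2)
      rw [e (by lia) (by lia), e (by lia) (by lia), e (by lia) (by lia), e (by lia) (by lia),
        ← mul_assoc, ← mul_assoc, ← ite_and, ← ite_and,
        mul_swap_eq_swap_mul, e (by lia) (by lia), e (by lia) (by lia)]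
      simp only [and_comm]
    · exact Commute.zero_right _
    · exact Commute.zero_left _
    · exact Commute.zero_left _
  braid k := by
    unfold simpleOp
    by_cases h : k + 1 + 1 < n
    · rw [dif_pos h, dif_pos (by lia)]
      refine LinearMap.ext fun F => funext fun w => ?_
      set a : Fin n := ⟨k, by lia⟩
      set b : Fin n := ⟨k + 1, by lia⟩
      set c : Fin n := ⟨k + 1 + 1, h⟩
      have hab : a ≠ b := by simp [a, b]
      have hac : a ≠ c := by simp [a, c]; lia
      have hbc : b ≠ c := by simp [b, c]
      simp only [Module.End.mul_apply, lowerOp_apply, symm_swap_mul_apply, swap_apply_left,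
        swap_apply_right, swap_apply_of_ne_of_ne hab hac, swap_apply_of_ne_of_ne hac.symm hbc.symm]
      have e : swap a b * (swap b c * (swap a b * w)) = swap b c * (swap a b * (swap b c * w)) := by
        simp only [← mul_assoc]
        congr 1
        rw [swap_mul_swap_mul_swap hab hac, swap_comm a b, swap_comm b c,
          swap_mul_swap_mul_swap hbc.symm hac.symm, swap_comm]
      rw [e]
      grind
    · rw [dif_neg h]; simp

theorem lengthOp_mul_simpleOp (k : ℕ) :
    lengthOp n * simpleOp n k = simpleOp n k * lengthOp n + simpleOp n k := by
  unfold simpleOp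
  split_ifs with h
  · refine LinearMap.ext fun F => funext fun w => ?_
    simp only [Module.End.mul_apply, LinearMap.add_apply, Pi.add_apply, lowerOp_apply,
      lengthOp_apply]
    split_ifs with h1
    · rw [invCount_of_descent rfl h1]; push_cast; ring
    · simp
  · simp

/-- Noninversions at the value `a` of `w` with a larger value. -/
def noninv (w : Perm (Fin n)) (a : Fin n) : ℕ :=
  (univ.filter (fun m : Fin n => a < w m ∧ w.symm a < m)).card

theorem noninv_of_lt {w : Perm (Fin n)} {a b : Fin n} (hab : b.val = a.val + 1)
    (h : w.symm a < w.symm b) :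
    noninv w a = bQ w (w.symm a) (w.symm b) + noninv w b + 1 := by
  have e : univ.filter (fun m : Fin n => a < w m ∧ w.symm a < m) =
      insert (w.symm b) (univ.filter (fun m : Fin n =>
          w.symm a < m ∧ m < w.symm b ∧ w (w.symm b) < w m) ∪
        univ.filter (fun m : Fin n => b < w m ∧ w.symm b < m)) := by
    ext m
    obtain ⟨x, rfl⟩ := w.symm.surjective m
    simp only [mem_filter, mem_univ, true_and, mem_insert, mem_union]
    simp only [apply_symm_apply, EmbeddingLike.apply_eq_iff_eq]
    have := w.symm.injective.eq_iff (a := x) (b := b)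
    grind
  rw [noninv, e, card_insert_of_notMem, card_union_of_disjoint]
  · rfl
  · rw [disjoint_filter]
    exact fun m _ h1 h2 => lt_asymm h1.2.1 h2.2
  · simp

theorem noninv_swap_mul {w : Perm (Fin n)} {a b : Fin n} (hab : b.val = a.val + 1)
    (h : w.symm a < w.symm b) :
    noninv (swap a b * w) a = noninv w b ∧ noninv (swap a b * w) b + 1 = noninv w a := by
  constructor
  · unfold noninv
    congr 1
    ext m
    obtain ⟨x, rfl⟩ := w.symm.surjective m
    simp only [mem_filter, mem_univ, true_and]
    simp only [Perm.mul_apply, symm_swap_mul_apply, apply_symm_apply, swap_apply_def]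
    grind
  · have e : univ.filter (fun m : Fin n => a < w m ∧ w.symm a < m) =
        insert (w.symm b) (univ.filter (fun m : Fin n => b < (swap a b * w) m ∧
          (swap a b * w).symm b < m)) := by
      ext m
      obtain ⟨x, rfl⟩ := w.symm.surjective m
      simp only [mem_filter, mem_univ, true_and, mem_insert]
      simp only [Perm.mul_apply, symm_swap_mul_apply, apply_symm_apply, swap_apply_def]
      have := w.symm.injective.eq_iff (a := x) (b := b)
      grind
    rw [noninv, noninv, e, card_insert_of_notMem]
    simp only [mem_filter, mem_univ, true_and]
    simp only [Perm.mul_apply, apply_symm_apply, swap_apply_right]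
    lia

/-- If a cover creates the left descent `a`, `b`, it is the one that exchanges these values. -/
theorem eq_of_cover_of_descent {w : Perm (Fin n)} {a b i j : Fin n} (hab : b.val = a.val + 1)
    (hw : w.symm a < w.symm b) (hij : i < j)
    (hc : invCount (w * swap i j) = invCount w + 1)
    (hd : (w * swap i j).symm b < (w * swap i j).symm a) : i = w.symm a ∧ j = w.symm b := by
  obtain ⟨h1, h2⟩ := cover_cond hij hc
  obtain ⟨x, rfl⟩ := w.symm.surjective i
  obtain ⟨y, rfl⟩ := w.symm.surjective j
  have e : ∀ z, (w * swap (w.symm x) (w.symm y)).symm z = swap (w.symm x) (w.symm y) (w.symm z) :=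
    fun z => rfl
  have h3 := h2 (w.symm a)
  have h4 := h2 (w.symm b)
  rw [e, e, swap_apply_def, swap_apply_def] at hd
  simp only [apply_symm_apply, EmbeddingLike.apply_eq_iff_eq] at *
  grind

theorem bQ_swap_mul {w : Perm (Fin n)} {a b i j : Fin n} (hab : b.val = a.val + 1)
    (hw : w.symm a < w.symm b) (hij : i < j)
    (hd : (w * swap i j).symm a < (w * swap i j).symm b) :
    bQ (swap a b * w) i j = bQ w i j := by
  unfold bQ
  congr 1
  ext m
  have e : ∀ z, (w * swap i j).symm z = swap i j (w.symm z) := fun z => rfl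
  rw [e, e, swap_apply_def, swap_apply_def] at hd
  obtain ⟨x, rfl⟩ := w.symm.surjective i
  obtain ⟨y, rfl⟩ := w.symm.surjective j
  obtain ⟨z, rfl⟩ := w.symm.surjective m
  simp only [mem_filter, mem_univ, true_and]
  simp only [Perm.mul_apply, apply_symm_apply, swap_apply_def, EmbeddingLike.apply_eq_iff_eq] at *
  grind

end Operators

section Commutator

variable {n : ℕ}

theorem codeOp_lowerOp {a b : Fin n} (hab : b.val = a.val + 1) (F : Perm (Fin n) → ℤ)
    (w : Perm (Fin n)) :
    codeOp n (lowerOp a b F) w = lowerOp a b (codeOp n F) w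
      + (2 * ((noninv w a : ℤ) - noninv w b) - 1) * F w := by
  have hne : a ≠ b := by rintro rfl; lia
  have key : ∀ {v : Perm (Fin n)}, v.symm a < v.symm b → ∀ p : Fin n × Fin n,
      p.1 < p.2 → invCount (v * swap p.1 p.2) = invCount v + 1 →
      (v * swap p.1 p.2).symm b < (v * swap p.1 p.2).symm a → p = (v.symm a, v.symm b) :=
    fun hv p h1 h2 h3 => by
      have := eq_of_cover_of_descent hab hv h1 h2 h3
      exact Prod.ext this.1 this.2
  have hswap : ∀ v : Perm (Fin n), v * swap (v.symm a) (v.symm b) = swap a b * v := fun v => by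
    rw [mul_swap_eq_swap_mul, apply_symm_apply, apply_symm_apply]
  rcases lt_trichotomy (w.symm a) (w.symm b) with h | h | h
  · rw [lowerOp_apply, if_neg (lt_asymm h), zero_add, codeOp_apply,
      sum_eq_single (w.symm a, w.symm b)]
    · have hc := invCount_swap_mul hab h
      rw [if_pos ⟨h, by rw [hswap, hc]⟩, hswap, lowerOp_apply, if_pos, swap_mul_self_mul,
        noninv_of_lt hab h]
      · push_cast; ring
      · simpa [symm_swap_mul_apply] using h
    · intro p _ hp
      rw [lowerOp_apply]
      split_ifs with h1 h2
      · exact absurd (key h p h1.1 h1.2 h2) hp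
      · simp
      · rfl
    · simp
  · exact absurd (w.symm.injective h) hne
  · obtain ⟨x, hx⟩ : ∃ x, x = swap a b * w := ⟨_, rfl⟩
    have hw : w = swap a b * x := by rw [hx, swap_mul_self_mul]
    have hxa : x.symm a < x.symm b := by simpa [hx, symm_swap_mul_apply] using h
    have hlw : invCount w = invCount x + 1 := by rw [hw]; exact invCount_swap_mul hab hxa
    rw [lowerOp_apply, if_pos h, ← hx, codeOp_apply, codeOp_apply]
    have hterm : ∀ p : Fin n × Fin n,
        (if p.1 < p.2 ∧ invCount (w * swap p.1 p.2) = invCount w + 1 then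
          (1 + 2 * (bQ w p.1 p.2 : ℤ)) * lowerOp a b F (w * swap p.1 p.2) else 0)
        = (if p.1 < p.2 ∧ invCount (x * swap p.1 p.2) = invCount x + 1 then
          (1 + 2 * (bQ x p.1 p.2 : ℤ)) * F (x * swap p.1 p.2) else 0)
          - if p = (x.symm a, x.symm b) then (1 + 2 * (bQ x p.1 p.2 : ℤ)) * F w else 0 := by
      intro p
      have hwt : w * swap p.1 p.2 = swap a b * (x * swap p.1 p.2) := by rw [hw, mul_assoc]
      by_cases hp : p = (x.symm a, x.symm b)
      · subst hp
        have hxw : x * swap (x.symm a) (x.symm b) = w := by rw [hswap, hw]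
        have hwx : w * swap (x.symm a) (x.symm b) = x := by
          rw [← hxw, mul_assoc, swap_mul_self, mul_one]
        simp only [hwx, hxw, if_true]
        rw [if_neg (by lia), if_pos ⟨hxa, hlw⟩, sub_self]
      · rw [if_neg hp, sub_zero, lowerOp_apply]
        by_cases hpp : p.1 < p.2
        swap
        · simp [hpp]
        simp only [hpp, true_and]
        set y := x * swap p.1 p.2 with hy
        rw [hwt]
        rcases lt_trichotomy (y.symm a) (y.symm b) with g | g | g
        · have hl := invCount_swap_mul hab g
          have hb : bQ w p.1 p.2 = bQ x p.1 p.2 := by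
            rw [hw]; exact bQ_swap_mul hab hxa hpp g
          have hi : (swap a b * y).symm b < (swap a b * y).symm a := by
            simpa [symm_swap_mul_apply] using g
          rw [hl, hlw, hb, if_pos hi, swap_mul_self_mul]
          simp only [add_left_inj]
        · exact absurd (y.symm.injective g) hne
        · have hi : ¬ (swap a b * y).symm b < (swap a b * y).symm a := by
            simpa [symm_swap_mul_apply] using g.le
          rw [if_neg hi, mul_zero, ite_self, if_neg]
          exact fun hc => hp (key hxa p hpp hc g)
    rw [sum_congr rfl fun p _ => hterm p, sum_sub_distrib, sum_ite_eq' univ, if_pos (mem_univ _)]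
    have h1 := noninv_of_lt hab hxa
    obtain ⟨h2, h3⟩ := noninv_swap_mul hab hxa
    rw [← hw] at h2 h3
    dsimp only
    have h4 : (noninv w b : ℤ) = bQ x (x.symm a) (x.symm b) + noninv w a := by
      rw [h2]; exact_mod_cast by lia
    rw [h4]
    ring

/-- The weighted sum of the lowering operators. -/
def lowerSum (n : ℕ) : Module.End ℤ (Perm (Fin n) → ℤ) :=
  ∑ k ∈ range (n - 1), ((k : Module.End ℤ (Perm (Fin n) → ℤ)) + 1) * simpleOp n k

theorem lowerSum_apply (F : Perm (Fin n) → ℤ) (w : Perm (Fin n)) :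
    lowerSum n F w = ∑ k ∈ range (n - 1), ((k : ℤ) + 1) * simpleOp n k F w := by
  simp [lowerSum, LinearMap.sum_apply, Module.End.mul_apply, add_mul]

theorem sum_noninv (w : Perm (Fin n)) : ∑ a, noninv w a + invCount w = n.choose 2 := by
  have h1 : ∑ a, noninv w a
      = (univ.filter (fun p : Fin n × Fin n => p.1 < p.2 ∧ w p.1 < w p.2)).card := by
    rw [card_filter, Fintype.sum_prod_type, ← Equiv.sum_comp w]
    refine sum_congr rfl fun a _ => ?_
    rw [noninv, card_filter]
    simp only [symm_apply_apply, and_comm]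
  rw [h1, invCount, ← card_lt_pairs, ← card_union_of_disjoint]
  · congr 1
    ext p
    simp only [mem_filter, mem_univ, true_and, mem_union]
    have := w.injective.ne_iff (x := p.1) (y := p.2)
    grind
  · rw [disjoint_filter]
    exact fun p _ h1 h2 => lt_asymm h1.2 h2.2

theorem sum_weighted_sub (f : ℕ → ℤ) (m : ℕ) :
    ∑ k ∈ range m, ((k : ℤ) + 1) * (2 * (f k - f (k + 1)) - 1)
      = 2 * ∑ k ∈ range (m + 1), f k - 2 * (m + 1) * f m - (m + 1).choose 2 := by
  induction m with
  | zero => simp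
  | succ m ih =>
    rw [sum_range_succ, ih, sum_range_succ _ (m + 1), Nat.choose_succ_succ' (m + 1) 1]
    push_cast
    simp only [Nat.choose_one_right]
    push_cast
    ring

theorem codeOp_lowerSum (F : Perm (Fin n) → ℤ) (w : Perm (Fin n)) :
    codeOp n (lowerSum n F) w = lowerSum n (codeOp n F) w
      + ((n.choose 2 : ℤ) - 2 * invCount w) * F w := by
  cases n with
  | zero => simp [lowerSum, codeOp_apply, invCount]
  | succ n =>
  set f : ℕ → ℤ := fun k => if h : k < n + 1 then (noninv w ⟨k, h⟩ : ℤ) else 0 with hf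
  have h1 : lowerSum (n + 1) F
      = ∑ k ∈ range n, ((k : ℤ) + 1) • simpleOp (n + 1) k F := by
    ext v
    simp [lowerSum_apply, Finset.sum_apply]
  rw [h1, map_sum, Finset.sum_apply, lowerSum_apply]
  have h2 : ∀ k ∈ range n, codeOp (n + 1) (((k : ℤ) + 1) • simpleOp (n + 1) k F) w
      = ((k : ℤ) + 1) * simpleOp (n + 1) k (codeOp (n + 1) F) w
        + ((k : ℤ) + 1) * (2 * (f k - f (k + 1)) - 1) * F w := by
    intro k hk
    have hk' := mem_range.1 hk
    rw [map_smul, Pi.smul_apply, smul_eq_mul, simpleOp, dif_pos (by lia), codeOp_lowerOp rfl]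
    simp only [hf]
    rw [dif_pos (by lia), dif_pos (by lia)]
    ring
  rw [sum_congr rfl h2, sum_add_distrib, ← sum_mul, sum_weighted_sub]
  have h3 : ∑ k ∈ range (n + 1), f k = ∑ a, (noninv w a : ℤ) := by
    rw [← Fin.sum_univ_eq_sum_range]
    exact sum_congr rfl fun a _ => by simp only [hf]; rw [dif_pos a.isLt]
  have h4 : f n = 0 := by
    simp only [hf, noninv]
    rw [dif_pos n.lt_succ_self, Nat.cast_eq_zero, card_eq_zero, filter_eq_empty_iff]
    intro m _ h
    have := h.1
    simp only [Fin.lt_def] at this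
    lia
  have h5 : ∑ a, (noninv w a : ℤ) + invCount w = (n + 1).choose 2 := mod_cast sum_noninv w
  have h6 : n + 1 - 1 = n := rfl
  rw [h3, h4, h6, ← h5]
  ring

end Commutator

section Schubert

variable {n : ℕ}

/-- The function sending a permutation to the value at `(1, …, 1)` of its Schubert polynomial. -/
def schub (n : ℕ) : Perm (Fin n) → ℤ :=
  schubProd (simpleOp n) (n - 1) (Pi.single 1 1)

theorem lowerSum_schub : lowerSum n (schub n) = lengthOp n (schub n) := by
  have h0 : lengthOp n (Pi.single 1 1) = 0 := by
    ext w
    rw [lengthOp_apply]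
    by_cases hw : w = 1
    · simp [hw, invCount_one]
    · simp [hw]
  have h := LinearMap.congr_fun
    (isNilCoxeter_simpleOp.bracket_schubProd (L := lengthOp n) lengthOp_mul_simpleOp (n - 1))
    (Pi.single 1 1)
  simp only [Module.End.mul_apply, LinearMap.add_apply, h0, map_zero, zero_add] at h
  exact h.symm

theorem codeOp_schub (w : Perm (Fin n)) :
    codeOp n (schub n) w = ((n.choose 2 : ℤ) - invCount w) * schub n w := by
  induction hl : invCount w using Nat.strong_induction_on generalizing w with
  | _ l ih =>
  have h1 : codeOp n (lengthOp n (schub n)) w = (l + 1) * codeOp n (schub n) w := by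
    rw [codeOp_apply, codeOp_apply, mul_sum]
    refine sum_congr rfl fun p _ => ?_
    split_ifs with h
    · rw [lengthOp_apply, h.2, hl]; push_cast; ring
    · simp
  have h2 : lowerSum n (codeOp n (schub n)) w
      = ((n.choose 2 : ℤ) - l + 1) * lowerSum n (schub n) w := by
    rw [lowerSum_apply, lowerSum_apply, mul_sum]
    refine sum_congr rfl fun k hk => ?_
    have hk' := mem_range.1 hk
    rw [simpleOp, dif_pos (by lia), lowerOp_apply, lowerOp_apply]
    split_ifs with h
    · have hd := invCount_of_descent rfl h
      rw [ih _ (by lia) _ rfl, ← hl, hd]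
      push_cast; ring
    · simp
  have h3 := codeOp_lowerSum (schub n) w
  rw [h2, lowerSum_schub, h1, lengthOp_apply, hl] at h3
  have h4 : (l : ℤ) + 1 ≠ 0 := by positivity
  apply mul_left_cancel₀ h4
  linear_combination h3

/-- Functions supported in length at most `r`, with value `1` at the identity and values `0` or `1`
in length `r`. -/
structure IsNormalized (r : ℕ) (F : Perm (Fin n) → ℤ) : Prop where
  one : F 1 = 1
  eq_zero : ∀ w, r < invCount w → F w = 0
  zero_or_one : ∀ w, invCount w = r → F w = 0 ∨ F w = 1

theorem isNormalized_single : IsNormalized 0 (Pi.single 1 1 : Perm (Fin n) → ℤ) where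
  one := by simp
  eq_zero w hw := by
    rw [Pi.single_eq_of_ne]
    rintro rfl
    simp [invCount_one] at hw
  zero_or_one w _ := by
    by_cases hw : w = 1 <;> simp [hw]

theorem IsNormalized.add_simpleOp {r : ℕ} {F : Perm (Fin n) → ℤ} (hF : IsNormalized r F) (k : ℕ) :
    IsNormalized (r + 1) ((1 + simpleOp n k) F) := by
  simp only [LinearMap.add_apply, Module.End.one_apply]
  unfold simpleOp
  split_ifs with h
  · constructor
    · rw [Pi.add_apply, hF.one, lowerOp_apply, if_neg, add_zero]
      simp [Equiv.Perm.one_def]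
    · intro w hw
      rw [Pi.add_apply, hF.eq_zero w (by lia), zero_add, lowerOp_apply]
      split_ifs with h1
      · have hd := invCount_of_descent rfl h1
        exact hF.eq_zero _ (by lia)
      · rfl
    · intro w hw
      rw [Pi.add_apply, hF.eq_zero w (by lia), zero_add, lowerOp_apply]
      split_ifs with h1
      · have hd := invCount_of_descent rfl h1
        exact hF.zero_or_one _ (by lia)
      · exact Or.inl rfl
  · simp only [LinearMap.zero_apply, add_zero]
    exact ⟨hF.one, fun w hw => hF.eq_zero w (by lia),
      fun w hw => Or.inl (hF.eq_zero w (by lia))⟩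

theorem IsNormalized.descProd {u : ℕ → Module.End ℤ (Perm (Fin n) → ℤ)}
    (hu : ∀ k r F, IsNormalized r F → IsNormalized (r + 1) ((1 + u k) F)) {r : ℕ}
    {F : Perm (Fin n) → ℤ} (hF : IsNormalized r F) (m : ℕ) :
    IsNormalized (r + m) (_root_.descProd u m F) := by
  induction m with
  | zero => exact hF
  | succ m ih => exact hu _ _ _ ih

theorem IsNormalized.schubProd {u : ℕ → Module.End ℤ (Perm (Fin n) → ℤ)}
    (hu : ∀ k r F, IsNormalized r F → IsNormalized (r + 1) ((1 + u k) F)) {r : ℕ}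
    {F : Perm (Fin n) → ℤ} (hF : IsNormalized r F) (m : ℕ) :
    IsNormalized (r + (m + 1).choose 2) (_root_.schubProd u m F) := by
  induction m generalizing u with
  | zero => exact hF
  | succ m ih =>
    have := (ih (u := fun k => u (k + 1)) fun k => hu _).descProd hu (m + 1)
    rw [add_assoc, add_comm _ (m + 1)] at this
    rw [Nat.choose_succ_succ' (m + 1) 1, Nat.choose_one_right]
    exact this

theorem isNormalized_schub : IsNormalized (n.choose 2) (schub n) := by
  have h := (isNormalized_single (n := n)).schubProd
    (fun k r F hF => IsNormalized.add_simpleOp hF k) (n - 1)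
  rw [zero_add] at h
  cases n with
  | zero => exact h
  | succ n => exact h

end Schubert

section Chains

variable {n : ℕ}

/-- The weighted count of the saturated chains with `m` steps. -/
noncomputable def chainSumOfLength (wt : Perm (Fin n) → Perm (Fin n) → ℕ) (m : ℕ)
    (v w : Perm (Fin n)) : ℕ :=
  ∑ c ∈ univ.filter (fun c : Fin (m + 1) → Perm (Fin n) =>
      c 0 = v ∧ c (Fin.last _) = w ∧ ∀ i : Fin m, BruhatCov (c i.castSucc) (c i.succ)),
    ∏ i : Fin m, wt (c i.castSucc) (c i.succ)

theorem chainSumOfLength_zero (wt : Perm (Fin n) → Perm (Fin n) → ℕ) (v w : Perm (Fin n)) :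
    chainSumOfLength wt 0 v w = if v = w then 1 else 0 := by
  rw [chainSumOfLength, sum_filter, ← Equiv.sum_comp (Equiv.funUnique (Fin 1) _).symm]
  simp only [Fin.isValue, Fin.last_zero, IsEmpty.forall_iff, and_true, univ_eq_empty, prod_empty]
  rw [sum_eq_single v]
  · simp
  · intro u _ hu
    rw [if_neg]
    exact fun h => hu h.1
  · simp

theorem chainSumOfLength_succ (wt : Perm (Fin n) → Perm (Fin n) → ℕ) (m : ℕ)
    (v w : Perm (Fin n)) :
    chainSumOfLength wt (m + 1) v w
      = ∑ u, if BruhatCov v u then wt v u * chainSumOfLength wt m u w else 0 := by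
  have h1 : ∀ u, (if BruhatCov v u then wt v u * chainSumOfLength wt m u w else 0)
      = ∑ c : Fin (m + 1) → Perm (Fin n), if u = c 0 then
          (if BruhatCov v (c 0) ∧ c (Fin.last _) = w ∧
              ∀ i : Fin m, BruhatCov (c i.castSucc) (c i.succ) then
            wt v (c 0) * ∏ i : Fin m, wt (c i.castSucc) (c i.succ) else 0) else 0 := by
    intro u
    rw [chainSumOfLength, sum_filter, mul_sum]
    by_cases hu : BruhatCov v u
    · rw [if_pos hu]
      refine sum_congr rfl fun c _ => ?_
      by_cases hc : u = c 0
      · subst hc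
        simp [hu]
      · rw [if_neg hc, if_neg (fun h => hc h.1.symm), mul_zero]
    · rw [if_neg hu]
      refine (sum_eq_zero fun c _ => ?_).symm
      split_ifs with hc hc'
      · exact absurd (hc ▸ hc'.1) hu
      all_goals rfl
  rw [sum_congr rfl fun u _ => h1 u, sum_comm, chainSumOfLength, sum_filter,
    ← Equiv.sum_comp (Fin.consEquiv fun _ => Perm (Fin n)), Fintype.sum_prod_type, sum_comm]
  refine sum_congr rfl fun c _ => ?_
  rw [sum_ite_eq' univ, if_pos (mem_univ _), sum_eq_single v]
  · simp only [Fin.consEquiv_apply, Fin.cons_zero, true_and, ← Fin.succ_last, Fin.cons_succ,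
      Fin.forall_fin_succ, Fin.castSucc_zero, ← Fin.succ_castSucc, Fin.prod_univ_succ]
    congr 1
    apply propext
    tauto
  · intro x _ hx
    rw [if_neg]
    exact fun h => hx h.1
  · simp

theorem sum_codeWt (G : Perm (Fin n) → ℤ) (v : Perm (Fin n)) :
    (∑ u, if BruhatCov v u then (codeWt v u : ℤ) * G u else 0) = codeOp n G v := by
  have h1 : ∀ u, (if BruhatCov v u then (codeWt v u : ℤ) * G u else 0)
      = ∑ p : Fin n × Fin n, if BruhatCov v u ∧ p.1 < p.2 ∧ u = v * swap p.1 p.2 then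
          (1 + 2 * (bQ v p.1 p.2 : ℤ)) * G u else 0 := by
    intro u
    by_cases hu : BruhatCov v u
    · simp only [hu, true_and, if_true]
      rw [codeWt, sum_filter]
      push_cast
      rw [sum_mul]
      exact sum_congr rfl fun p _ => by split_ifs <;> simp
    · simp [hu]
  rw [sum_congr rfl fun u _ => h1 u, sum_comm, codeOp_apply]
  refine sum_congr rfl fun p _ => ?_
  rw [sum_eq_single (v * swap p.1 p.2)]
  · refine if_congr ⟨fun h => ⟨h.2.1, ?_⟩, fun h => ⟨⟨p.1, p.2, h.1, rfl, h.2⟩, h.1, rfl⟩⟩ rfl rfl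
    obtain ⟨_, _, _, _, h⟩ := h.1
    exact h
  · intro u _ hu
    rw [if_neg]
    exact fun h => hu h.2.2
  · simp

theorem chainSumOfLength_mul_schub {m : ℕ} {v : Perm (Fin n)} (h : invCount v + m = n.choose 2) :
    (chainSumOfLength codeWt m v Fin.revPerm : ℤ) * schub n Fin.revPerm
      = m.factorial * schub n v := by
  induction m generalizing v with
  | zero =>
    rw [eq_revPerm_of_invCount (w := v) h, chainSumOfLength_zero]
    simp
  | succ m ih =>
    rw [chainSumOfLength_succ]
    push_cast
    rw [sum_mul]
    have h1 : ∀ u, ((if BruhatCov v u then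
          (codeWt v u : ℤ) * (chainSumOfLength codeWt m u Fin.revPerm : ℤ) else 0)
        * schub n Fin.revPerm) = m.factorial *
          (if BruhatCov v u then (codeWt v u : ℤ) * schub n u else 0) := by
      intro u
      split_ifs with hu
      · obtain ⟨_, _, _, _, hl⟩ := hu
        rw [mul_assoc, ih (by lia)]
        ring
      · simp
    rw [sum_congr rfl fun u _ => h1 u, ← mul_sum, sum_codeWt, codeOp_schub, ← h,
      Nat.factorial_succ]
    push_cast
    ring

end Chains

theorem codeWeight_chain_count (n : ℕ) :
    chainSum codeWt (1 : Equiv.Perm (Fin n)) Fin.revPerm = (n.choose 2).factorial := by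
  have h0 : chainSum codeWt (1 : Equiv.Perm (Fin n)) Fin.revPerm
      = chainSumOfLength codeWt (n.choose 2) (1 : Perm (Fin n)) Fin.revPerm := by
    have : invCount (Fin.revPerm : Perm (Fin n)) - invCount (1 : Perm (Fin n)) = n.choose 2 := by
      rw [invCount_one, invCount_revPerm, Nat.sub_zero]
    rw [← this]
    rfl
  have h1 := chainSumOfLength_mul_schub (n := n) (m := n.choose 2) (v := 1)
    (by rw [invCount_one, zero_add])
  rw [isNormalized_schub.one, mul_one] at h1
  rcases isNormalized_schub.zero_or_one _ (invCount_revPerm (n := n)) with h2 | h2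
  · rw [h2, mul_zero] at h1
    exact absurd h1.symm (mod_cast Nat.factorial_ne_zero _)
  · rw [h2, mul_one] at h1
    rw [h0]
    exact_mod_cast h1
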